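/- arXiv:2101.05531 — 2 statements merged into one kernel-verified Lean document; each statement's English description precedes it below -/
import Mathlib

section
/- Let R be an order in L with σ(R) = R and let I and J be fractional R-ideals. Assume that there exists a fractional R-ideal K with K·J^t = R. Then K·σ(K)·σ(I)^t = (J : σ((J : I))^t). -/
variable {L : Type*} [CommRing L] [Algebra ℚ L]

/-- A full lattice in `L`: a finitely generated `ℤ`-submodule containing a `ℚ`-basis of `L`
(equivalently, spanning `L` over `ℚ`). -/
def IsFullLattice (I : Submodule ℤ L) : Prop :=
  I.FG ∧ Submodule.span ℚ (I : Set L) = ⊤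

/-- The trace dual lattice `I^t = {x ∈ L : Tr_{L/ℚ}(x·y) ∈ ℤ for all y ∈ I}`. -/
def traceDual (I : Submodule ℤ L) : Submodule ℤ L where
  carrier := {x | ∀ y ∈ I, ∃ n : ℤ, Algebra.trace ℚ L (x * y) = (n : ℚ)}
  zero_mem' := fun y _ => ⟨0, by simp⟩
  add_mem' := by
    intro a b ha hb y hy
    obtain ⟨m, hm⟩ := ha y hy
    obtain ⟨n, hn⟩ := hb y hy
    exact ⟨m + n, by rw [add_mul, map_add, hm, hn]; push_cast; ring⟩
  smul_mem' := by
    intro c x hx y hy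
    obtain ⟨n, hn⟩ := hx y hy
    refine ⟨c * n, ?_⟩
    rw [smul_mul_assoc, map_zsmul, hn, zsmul_eq_mul]
    push_cast
    ring

/-- An order in `L`: a full lattice that is also a subring of `L`. -/
def IsOrderLattice (R : Submodule ℤ L) : Prop :=
  IsFullLattice R ∧ (1 : L) ∈ R ∧ ∀ x ∈ R, ∀ y ∈ R, x * y ∈ R

/-- A fractional `R`-ideal: a full lattice that is an `R`-submodule of `L`. -/
def IsFracIdeal (R I : Submodule ℤ L) : Prop :=
  IsFullLattice I ∧ ∀ r ∈ R, ∀ x ∈ I, r * x ∈ I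

/-- The image of a full lattice under a `ℚ`-algebra automorphism `σ`, as a `ℤ`-submodule. -/
def latMap (σ : L ≃ₐ[ℚ] L) (X : Submodule ℤ L) : Submodule ℤ L :=
  X.map (AddMonoidHom.toIntLinearMap (RingHom.toAddMonoidHom (σ : L →+* L)))

lemma mem_traceDual {I : Submodule ℤ L} {x : L} :
    x ∈ traceDual I ↔ ∀ y ∈ I, ∃ n : ℤ, Algebra.trace ℚ L (x * y) = (n : ℚ) := Iff.rfl

lemma traceDual_eq_dualSubmodule (I : Submodule ℤ L) :
    traceDual I = (Algebra.traceForm ℚ L).dualSubmodule I := by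
  ext x
  simp only [mem_traceDual, LinearMap.BilinForm.mem_dualSubmodule, Submodule.mem_one,
    Algebra.traceForm_apply, eq_comm, algebraMap_int_eq, eq_intCast]

lemma traceDual_anti {X Y : Submodule ℤ L} (h : X ≤ Y) : traceDual Y ≤ traceDual X :=
  fun _ hx y hy => hx y (h hy)

lemma traceDual_mul (X Y : Submodule ℤ L) : traceDual (X * Y) = traceDual X / Y := by
  ext z
  simp only [Submodule.mem_div_iff_forall_mul_mem, mem_traceDual]
  refine ⟨fun h y hy x hx => ?_, fun h w hw => ?_⟩
  · rw [mul_assoc, mul_comm y]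
    exact h _ (Submodule.mul_mem_mul hx hy)
  · induction hw using Submodule.mul_induction_on' with
    | mem_mul_mem x hx y hy =>
      rw [mul_comm x, ← mul_assoc]
      exact h y hy x hx
    | add a _ b _ ha hb =>
      obtain ⟨m, hm⟩ := ha
      obtain ⟨n, hn⟩ := hb
      exact ⟨m + n, by rw [mul_add, map_add, hm, hn, Int.cast_add]⟩

lemma traceForm_nondegenerate_of_forall [FiniteDimensional ℚ L]
    (hnd : ∀ x : L, (∀ y : L, Algebra.trace ℚ L (x * y) = 0) → x = 0) :
    (Algebra.traceForm ℚ L).Nondegenerate :=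
  ⟨hnd, fun y hy => hnd y fun x => by rw [mul_comm]; exact hy x⟩

lemma isFullLattice_span_basis {ι : Type*} [Finite ι] (b : Module.Basis ι ℚ L) :
    IsFullLattice (Submodule.span ℤ (Set.range b)) :=
  ⟨Submodule.fg_span (Set.finite_range b), by
    rw [Submodule.span_span_of_tower, b.span_eq]⟩

lemma IsFullLattice.exists_basis {I : Submodule ℤ L} (hI : IsFullLattice I) :
    ∃ (n : ℕ) (b : Module.Basis (Fin n) ℚ L), Submodule.span ℤ (Set.range b) = I := by
  have : Submodule.IsLattice ℚ I := ⟨hI.1, hI.2⟩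
  have := Submodule.IsLattice.free (K := ℚ) I
  let b := Module.finBasis ℤ I
  refine ⟨_, b.extendOfIsLattice ℚ, ?_⟩
  have h : ⇑(b.extendOfIsLattice ℚ) = I.subtype ∘ b := by
    ext i
    simp
  rw [h, Set.range_comp, ← Submodule.map_span, b.span_eq, Submodule.map_top,
    Submodule.range_subtype]

lemma IsFullLattice.traceDual [FiniteDimensional ℚ L]
    (hB : (Algebra.traceForm ℚ L).Nondegenerate) {I : Submodule ℤ L} (hI : IsFullLattice I) :
    IsFullLattice (traceDual I) := by
  obtain ⟨n, b, rfl⟩ := hI.exists_basis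
  rw [traceDual_eq_dualSubmodule, LinearMap.BilinForm.dualSubmodule_span_of_basis _ hB]
  exact isFullLattice_span_basis _

lemma IsFullLattice.traceDual_traceDual
    (hB : (Algebra.traceForm ℚ L).Nondegenerate) {I : Submodule ℤ L} (hI : IsFullLattice I) :
    _root_.traceDual (_root_.traceDual I) = I := by
  obtain ⟨n, b, rfl⟩ := hI.exists_basis
  simp only [traceDual_eq_dualSubmodule]
  exact LinearMap.BilinForm.dualSubmodule_dualSubmodule_of_basis _ hB
    (Algebra.traceForm_isSymm ℚ) b

open scoped Pointwise in
lemma IsFullLattice.mul {X Y : Submodule ℤ L} (hX : IsFullLattice X) (hY : IsFullLattice Y) :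
    IsFullLattice (X * Y) := by
  refine ⟨hX.1.mul hY.1, top_le_iff.mp ?_⟩
  calc (⊤ : Submodule ℚ L)
      ≤ ⊤ * ⊤ := fun x _ => by
        simpa using Submodule.mul_mem_mul (Submodule.mem_top (R := ℚ) (x := x))
          (Submodule.mem_top (R := ℚ) (x := (1 : L)))
    _ = Submodule.span ℚ ((X : Set L) * (Y : Set L)) := by
        rw [← Submodule.span_mul_span, hX.2, hY.2]
    _ ≤ _ := Submodule.span_mono (Set.mul_subset_iff.mpr fun _ hx _ hy =>
        Submodule.mul_mem_mul hx hy)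

lemma IsFullLattice.div_eq_traceDual
    (hB : (Algebra.traceForm ℚ L).Nondegenerate) {J : Submodule ℤ L} (hJ : IsFullLattice J)
    (X : Submodule ℤ L) : J / X = _root_.traceDual (_root_.traceDual J * X) := by
  rw [traceDual_mul, hJ.traceDual_traceDual hB]

lemma mem_latMap {σ : L ≃ₐ[ℚ] L} {X : Submodule ℤ L} {x : L} :
    x ∈ latMap σ X ↔ ∃ y ∈ X, σ y = x := Iff.rfl

lemma latMap_mul (σ : L ≃ₐ[ℚ] L) (X Y : Submodule ℤ L) :
    latMap σ (X * Y) = latMap σ X * latMap σ Y :=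
  Submodule.map_mul X Y (RingHom.toIntAlgHom (σ : L →+* L))

lemma latMap_traceDual (σ : L ≃ₐ[ℚ] L) (X : Submodule ℤ L) :
    latMap σ (traceDual X) = traceDual (latMap σ X) := by
  ext x
  obtain ⟨x, rfl⟩ := σ.surjective x
  simp only [mem_latMap, EmbeddingLike.apply_eq_iff_eq, exists_eq_right, mem_traceDual,
    forall_exists_index, and_imp, forall_apply_eq_imp_iff₂, ← map_mul,
    Algebra.trace_eq_of_algEquiv σ]

lemma IsFullLattice.latMap {X : Submodule ℤ L} (hX : IsFullLattice X) (σ : L ≃ₐ[ℚ] L) :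
    IsFullLattice (latMap σ X) := by
  refine ⟨hX.1.map _, ?_⟩
  have h : ((_root_.latMap σ X : Submodule ℤ L) : Set L) = σ.toLinearMap '' X := rfl
  rw [h, ← Submodule.map_span, hX.2, Submodule.map_top, LinearMap.range_eq_top]
  exact σ.surjective

/-- Multiplying a trace dual by an invertible ideal: if `K * Q = R`, then `K * A^t = (Q * A)^t`. -/
lemma mul_traceDual_of_mul_eq {R K Q A : Submodule ℤ L} (h1 : 1 ∈ R) (hKQ : K * Q = R)
    (hRA : R * A ≤ A) : K * traceDual A = traceDual (Q * A) := by
  rw [mul_comm Q, traceDual_mul]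
  apply le_antisymm
  · rw [Submodule.le_div_iff_mul_le, mul_right_comm, hKQ, mul_comm, ← Submodule.le_div_iff_mul_le,
      ← traceDual_mul]
    exact traceDual_anti (mul_comm R A ▸ hRA)
  · calc traceDual A / Q
        ≤ R * (traceDual A / Q) := fun x hx => by simpa using Submodule.mul_mem_mul h1 hx
      _ = K * (traceDual A / Q * Q) := by rw [← hKQ, mul_assoc, mul_comm Q]
      _ ≤ K * traceDual A := mul_le_mul_right (Submodule.le_div_iff_mul_le.mp le_rfl) _

/-- Let `L` be an étale `ℚ`-algebra, `σ` a `ℚ`-algebra involution of `L`,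
`R` an order with `σ(R) = R`, and `I`, `J` fractional `R`-ideals.  If there exists a
fractional `R`-ideal `K` with `K·J^t = R`, then `K·σ(K)·σ(I)^t = (J : σ((J : I))^t)`.
Here `(J : I)` is written `J / I`. -/
theorem mul_conj_traceDual_eq_colon [FiniteDimensional ℚ L]
    (hnd : ∀ x : L, (∀ y : L, Algebra.trace ℚ L (x * y) = 0) → x = 0)
    (σ : L ≃ₐ[ℚ] L) (hσ2 : ∀ x : L, σ (σ x) = x)
    (R I J K : Submodule ℤ L) (hR : IsOrderLattice R) (hRσ : latMap σ R = R)
    (hI : IsFracIdeal R I) (hJ : IsFracIdeal R J) (hK : IsFracIdeal R K)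
    (hKJt : K * traceDual J = R) :
    K * latMap σ K * traceDual (latMap σ I) = J / traceDual (latMap σ (J / I)) := by
  have hB := traceForm_nondegenerate_of_forall hnd
  have hRI : R * latMap σ I ≤ latMap σ I := by
    nth_rewrite 1 [← hRσ]
    rw [← latMap_mul]
    exact Submodule.map_mono (Submodule.mul_le.mpr hI.2)
  have hσ : latMap σ K * latMap σ (traceDual J) = R := by rw [← latMap_mul, hKJt, hRσ]
  have hfull := ((hJ.1.traceDual hB).latMap σ).mul (hI.1.latMap σ)
  rw [mul_assoc, mul_traceDual_of_mul_eq hR.2.1 hσ hRI,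
    mul_traceDual_of_mul_eq hR.2.1 hKJt ?_, hJ.1.div_eq_traceDual hB I, latMap_traceDual σ (_ * _),
    latMap_mul, hfull.traceDual_traceDual hB, hJ.1.div_eq_traceDual hB]
  rw [mul_left_comm]
  exact mul_le_mul_right hRI _
end

section
/- Let S and T be orders in L with σ(T) = T, let 𝒯 ⊆ Tˣ be a transversal of Tˣ modulo H, let i₀ ∈ L be nonzero, and let b ∈ L be nonzero totally imaginary. Assume that every totally real unit of S is a unit of T. Then for every totally real unit c of S there is a bijection between P_1(Φ_b) and P_1(Φ_{c·b}). -/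
variable {L : Type*} [Field L] [NumberField L]

/-- `x ∈ L` is totally real w.r.t. the CM involution `σ`. -/
def TotallyReal (σ : L ≃ₐ[ℚ] L) (x : L) : Prop := σ x = x

/-- `x ∈ L` is totally imaginary w.r.t. the CM involution `σ`. -/
def TotallyImaginary (σ : L ≃ₐ[ℚ] L) (x : L) : Prop := σ x = -x

/-- `x ∈ L` is totally positive: totally real and every complex embedding sends it to a
positive real number. -/
def TotallyPositive (σ : L ≃ₐ[ℚ] L) (x : L) : Prop :=
  σ x = x ∧ ∀ φ : L →+* ℂ, (φ x).im = 0 ∧ 0 < (φ x).re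

/-- The CM-type `Φ_b` attached to a (nonzero totally imaginary) element `b ∈ L`:
the set of complex embeddings `φ` with `Im (φ b) > 0`. -/
def CMType (b : L) : Set (L →+* ℂ) := {φ | 0 < (φ b).im}

/-- `x ∈ L` is `Φ_b`-positive: `Im (φ x) > 0` for every `φ ∈ Φ_b`. -/
def PhiPositive (b x : L) : Prop := ∀ φ ∈ CMType b, 0 < (φ x).im

/-- A unit of an order (subring) `T` of `L`: an element of `T` with an inverse in `T`. -/
def IsUnitOfOrder (T : Subring L) (u : L) : Prop := u ∈ T ∧ ∃ v ∈ T, u * v = 1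

/-- An order in `L`: a subring which is finitely generated as a `ℤ`-module and contains a
`ℚ`-basis of `L` (i.e. spans `L` over `ℚ`). -/
def IsOrder (T : Subring L) : Prop :=
  (Submodule.span ℤ (T : Set L)).FG ∧ Submodule.span ℚ (T : Set L) = ⊤

/-- `𝒯` is a transversal of `Tˣ` modulo the subgroup `H` generated by
`{v·σ(v) : v ∈ Tˣ}` (when `σ(T) = T` this generating set is itself a subgroup, since it is
closed under products and inverses, so `H = {v·σ(v) : v ∈ Tˣ}`): every unit of `T` is
congruent modulo `H` to exactly one element of `𝒯`. -/
def IsTransversal (σ : L ≃ₐ[ℚ] L) (T : Subring L) (𝒯 : Set L) : Prop :=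
  (∀ u ∈ 𝒯, IsUnitOfOrder T u) ∧
  ∀ u : L, IsUnitOfOrder T u →
    ∃! t : L, t ∈ 𝒯 ∧ ∃ v : L, IsUnitOfOrder T v ∧ u = t * (v * σ v)

/-- The set `P_α(Φ_b) = {i₀·u : u ∈ 𝒯 such that α⁻¹·i₀·u is totally imaginary and
Φ_b-positive}`; the set `P_1(Φ_b)` is the special case `α = 1`. -/
def Pset (σ : L ≃ₐ[ℚ] L) (𝒯 : Set L) (i₀ α b : L) : Set L :=
  {x | ∃ u ∈ 𝒯, x = i₀ * u ∧ TotallyImaginary σ (α⁻¹ * (i₀ * u)) ∧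
    PhiPositive b (α⁻¹ * (i₀ * u))}

theorem IsUnitOfOrder.mul {T : Subring L} {u v : L} (hu : IsUnitOfOrder T u)
    (hv : IsUnitOfOrder T v) : IsUnitOfOrder T (u * v) := by
  obtain ⟨hu, u', hu', huu⟩ := hu
  obtain ⟨hv, v', hv', hvv⟩ := hv
  exact ⟨T.mul_mem hu hv, u' * v', T.mul_mem hu' hv', by rw [mul_mul_mul_comm, huu, hvv, one_mul]⟩

theorem IsUnitOfOrder.one (T : Subring L) : IsUnitOfOrder T 1 :=
  ⟨T.one_mem, 1, T.one_mem, one_mul 1⟩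

theorem IsUnitOfOrder.ne_zero {T : Subring L} {u : L} (hu : IsUnitOfOrder T u) : u ≠ 0 := by
  obtain ⟨-, v, -, h⟩ := hu
  exact left_ne_zero_of_mul_eq_one h

/-- Two elements of a transversal that are congruent modulo `H` are equal. -/
theorem IsTransversal.eq_of_eq_mul {σ : L ≃ₐ[ℚ] L} {T : Subring L} {𝒯 : Set L}
    (h𝒯 : IsTransversal σ T 𝒯) {u u' v : L} (hu : u ∈ 𝒯) (hu' : u' ∈ 𝒯)
    (hv : IsUnitOfOrder T v) (h : u = u' * (v * σ v)) : u = u' :=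
  (h𝒯.2 u (h𝒯.1 u hu)).unique ⟨hu, 1, IsUnitOfOrder.one T, by simp⟩ ⟨hu', v, hv, h⟩

/-- A totally imaginary `Φ_b`-positive element has negative imaginary part at the embeddings
conjugate to those of `Φ_b`. -/
theorem PhiPositive.im_neg {σ : L ≃ₐ[ℚ] L} {b x : L} (h : PhiPositive b x)
    (hb : TotallyImaginary σ b) (hx : TotallyImaginary σ x) (φ : L →+* ℂ)
    (hφ : (φ b).im < 0) : (φ x).im < 0 := by
  have hmem : φ.comp (σ : L →+* L) ∈ CMType b := by
    change 0 < (φ (σ b)).im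
    rw [hb, map_neg, Complex.neg_im]
    linarith
  have hpos : 0 < (φ (σ x)).im := h _ hmem
  rw [hx, map_neg, Complex.neg_im] at hpos
  linarith

/-- Twisting by a totally real `c`: if `x` is totally imaginary and `Φ_b`-positive and
`c * x = y * (v * σ v)`, then `y` is `Φ_{c * b}`-positive. -/
theorem PhiPositive.of_mul_eq {σ : L ≃ₐ[ℚ] L}
    (hσ : ∀ (φ : L →+* ℂ) (x : L), φ (σ x) = (starRingEnd ℂ) (φ x))
    {b c x y v : L} (h : PhiPositive b x) (hb : TotallyImaginary σ b)
    (hx : TotallyImaginary σ x) (hc : TotallyReal σ c) (hy : c * x = y * (v * σ v)) :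
    PhiPositive (c * b) y := by
  intro φ hφ
  have hcim : (φ c).im = 0 := by
    rw [← Complex.conj_eq_iff_im, ← hσ, hc]
  have hφ' : 0 < (φ c).re * (φ b).im := by
    have : 0 < (φ (c * b)).im := hφ
    simpa [Complex.mul_im, hcim] using this
  have key : (φ c).re * (φ x).im = (φ y).im * Complex.normSq (φ v) := by
    have := congrArg (fun z => (φ z).im) hy
    simpa [hσ, Complex.mul_conj, Complex.mul_im, hcim] using this
  have hpos : 0 < (φ c).re * (φ x).im := by
    rcases mul_pos_iff.mp hφ' with ⟨h₁, h₂⟩ | ⟨h₁, h₂⟩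
    · exact mul_pos h₁ (h φ h₂)
    · exact mul_pos_of_neg_of_neg h₁ (h.im_neg hb hx φ h₂)
  rw [key] at hpos
  exact pos_of_mul_pos_left hpos (Complex.normSq_nonneg _)

theorem TotallyImaginary.of_mul_eq {σ : L ≃ₐ[ℚ] L} (hσσ : ∀ x, σ (σ x) = x) {c x y v : L}
    (hx : TotallyImaginary σ x) (hc : TotallyReal σ c) (hv : v ≠ 0)
    (hy : c * x = y * (v * σ v)) : TotallyImaginary σ y := by
  have hne : v * σ v ≠ 0 := mul_ne_zero hv (by simpa using hv)
  have h := congrArg σ hy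
  rw [map_mul, map_mul, map_mul, hσσ, hc, hx, mul_neg, hy, mul_comm (σ v) v] at h
  exact mul_right_cancel₀ hne (by rw [← h, neg_mul])

theorem involutive_of_conj {σ : L ≃ₐ[ℚ] L}
    (hσ : ∀ (φ : L →+* ℂ) (x : L), φ (σ x) = (starRingEnd ℂ) (φ x)) (x : L) :
    σ (σ x) = x := by
  obtain ⟨φ⟩ : Nonempty (L →+* ℂ) := inferInstance
  apply φ.injective
  rw [hσ, hσ, Complex.conj_conj]

/-- Two elements of `P_1` that are congruent modulo `H` are equal. -/
theorem Pset_one_eq_of_eq_mul {σ : L ≃ₐ[ℚ] L} {T : Subring L} {𝒯 : Set L}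
    (h𝒯 : IsTransversal σ T 𝒯) {i₀ b x x' v : L} (hi₀ : i₀ ≠ 0)
    (hx : x ∈ Pset σ 𝒯 i₀ 1 b) (hx' : x' ∈ Pset σ 𝒯 i₀ 1 b)
    (hv : IsUnitOfOrder T v) (h : x = x' * (v * σ v)) : x = x' := by
  obtain ⟨u, hu, rfl, -⟩ := hx
  obtain ⟨u', hu', rfl, -⟩ := hx'
  rw [h𝒯.eq_of_eq_mul hu hu' hv (mul_left_cancel₀ hi₀ (by rw [h, mul_assoc]))]

/-- Multiplication by a totally real unit `c` of `T` carries `P_1(Φ_b)` into `P_1(Φ_{c * b})`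
modulo `H`. -/
theorem exists_mem_Pset_one_mul {σ : L ≃ₐ[ℚ] L}
    (hσ : ∀ (φ : L →+* ℂ) (x : L), φ (σ x) = (starRingEnd ℂ) (φ x))
    {T : Subring L} {𝒯 : Set L} (h𝒯 : IsTransversal σ T 𝒯) {i₀ b c : L}
    (hb : TotallyImaginary σ b) (hc : TotallyReal σ c) (hcT : IsUnitOfOrder T c)
    (x : Pset σ 𝒯 i₀ 1 b) :
    ∃ y : Pset σ 𝒯 i₀ 1 (c * b), ∃ v, IsUnitOfOrder T v ∧ c * x = y * (v * σ v) := by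
  obtain ⟨_, u, hu, rfl, him, hpos⟩ := x
  rw [inv_one, one_mul] at him hpos
  obtain ⟨t, ⟨ht, v, hv, h⟩, -⟩ := h𝒯.2 (c * u) (hcT.mul (h𝒯.1 u hu))
  have hy : c * (i₀ * u) = i₀ * t * (v * σ v) := by
    rw [mul_left_comm, h, mul_assoc]
  refine ⟨⟨i₀ * t, t, ht, rfl, ?_, ?_⟩, v, hv, hy⟩ <;> rw [inv_one, one_mul]
  · exact him.of_mul_eq (involutive_of_conj hσ) hc hv.ne_zero hy
  · exact hpos.of_mul_eq hσ hb him hc hy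

/-- Theorem 5.10, (1) ⇒ (5): With `S`, `T` orders in `L`, `T` stable
under `σ`, `𝒯` a transversal of `Tˣ` modulo `H`, `i₀ ∈ L` nonzero and `b ∈ L` nonzero
totally imaginary, if every totally real unit of `S` is a unit of `T`, then for every
totally real unit `c` of `S` there is a bijection between `P_1(Φ_b)` and `P_1(Φ_{c·b})`. -/
theorem Pset_one_equiv_of_units_subset (σ : L ≃ₐ[ℚ] L)
    (hσ : ∀ (φ : L →+* ℂ) (x : L), φ (σ x) = (starRingEnd ℂ) (φ x))
    (S T : Subring L) (hS : IsOrder S) (hT : IsOrder T)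
    (hTσ : ∀ x : L, σ x ∈ T ↔ x ∈ T)
    (𝒯 : Set L) (h𝒯 : IsTransversal σ T 𝒯)
    (i₀ : L) (hi₀ : i₀ ≠ 0)
    (b : L) (hb0 : b ≠ 0) (hb : TotallyImaginary σ b)
    (hST : ∀ ξ : L, TotallyReal σ ξ → IsUnitOfOrder S ξ → IsUnitOfOrder T ξ) :
    ∀ c : L, TotallyReal σ c → IsUnitOfOrder S c →
      Nonempty (Pset σ 𝒯 i₀ 1 b ≃ Pset σ 𝒯 i₀ 1 (c * b)) := by
  intro c hc hcS
  have hcT := hST c hc hcS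
  obtain ⟨d, hdT, hcd⟩ := hcT.2
  have hdTu : IsUnitOfOrder T d := ⟨hdT, c, hcT.1, by rw [mul_comm, hcd]⟩
  have hd : TotallyReal σ d := by
    have h := congrArg σ hcd
    rw [map_mul, map_one, hc, ← hcd] at h
    exact mul_left_cancel₀ hcT.ne_zero h
  have hcb : TotallyImaginary σ (c * b) := by
    rw [TotallyImaginary, map_mul, hc, hb, mul_neg]
  choose f v hv hf using exists_mem_Pset_one_mul (i₀ := i₀) hσ h𝒯 hb hc hcT
  have hback := exists_mem_Pset_one_mul (i₀ := i₀) hσ h𝒯 hcb hd hdTu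
  rw [← mul_assoc, mul_comm d c, hcd, one_mul] at hback
  choose g w hw hg using hback
  refine ⟨⟨f, g, fun x => ?_, fun y => ?_⟩⟩
  · refine Subtype.ext (Pset_one_eq_of_eq_mul h𝒯 hi₀ x.2 (g (f x)).2
      ((hw (f x)).mul (hv x)) ?_).symm
    rw [map_mul]
    linear_combination (-(x : L)) * hcd + d * hf x + (v x * σ (v x)) * hg (f x)
  · refine Subtype.ext (Pset_one_eq_of_eq_mul h𝒯 hi₀ y.2 (f (g y)).2
      ((hv (g y)).mul (hw y)) ?_).symm
    rw [map_mul]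
    linear_combination (-(y : L)) * hcd + c * hg y + (w y * σ (w y)) * hf (g y)
end
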